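/- Let A be a real Hurwitz matrix and C a real matrix with Cᵀ C positive definite. Then there exists a unique symmetric positive definite matrix Q satisfying Aᵀ Q + Q A + Cᵀ C = 0. -/

import Mathlib

open Matrix

def IsHurwitz {N : ℕ} (A : Matrix (Fin N) (Fin N) ℝ) : Prop :=
  ∀ μ ∈ spectrum ℂ (A.map (Complex.ofReal)), μ.re < 0

open Filter Topology Polynomial

section Spectrum

variable {n : Type*} [Fintype n] [DecidableEq n]

theorem SemiconjBy.polynomial_aeval {R S : Type*} [CommSemiring R] [Semiring S] [Algebra R S]
    {x a b : S} (h : SemiconjBy x a b) (f : R[X]) :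
    SemiconjBy x (aeval a f) (aeval b f) := by
  induction f using Polynomial.induction_on' with
  | add f g hf hg => simpa using hf.add_right hg
  | monomial k c =>
    simp only [aeval_monomial]
    exact SemiconjBy.mul_right (Algebra.commutes c x).symm (h.pow_right k)

/-- Sylvester: only the zero matrix intertwines two matrices with disjoint spectra. -/
theorem Matrix.eq_zero_of_semiconjBy_of_disjoint_spectrum {K : Type*} [Field K] [IsAlgClosed K]
    {A B X : Matrix n n K} (h : SemiconjBy X A B)
    (hd : Disjoint (spectrum K A) (spectrum K B)) : X = 0 := by
  nontriviality Matrix n n K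
  have hX : X * aeval A B.charpoly = 0 := by
    simpa [Matrix.aeval_self_charpoly] using (h.polynomial_aeval B.charpoly).eq
  have hu : IsUnit (aeval A B.charpoly) := by
    rw [← spectrum.zero_notMem_iff K, spectrum.map_polynomial_aeval_of_nonempty A _
      (spectrum.nonempty_of_isAlgClosed_of_finiteDimensional K A)]
    rintro ⟨μ, hμ, h0⟩
    exact Set.disjoint_left.mp hd hμ (Matrix.mem_spectrum_iff_isRoot_charpoly.mpr h0)
  exact hu.mul_left_eq_zero.mp hX

theorem tendsto_pow_atTop_nhds_zero_of_spectralRadius_lt_one {𝔸 : Type*} [NormedRing 𝔸]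
    [NormedAlgebra ℂ 𝔸] [CompleteSpace 𝔸] {a : 𝔸} (ha : spectralRadius ℂ a < 1) :
    Tendsto (fun k : ℕ => a ^ k) atTop (𝓝 0) := by
  obtain ⟨r, har, hr1⟩ := ENNReal.lt_iff_exists_nnreal_btwn.mp ha
  have hr : Tendsto (fun k : ℕ => (r : ℝ) ^ k) atTop (𝓝 0) :=
    tendsto_pow_atTop_nhds_zero_of_lt_one r.2 (by exact_mod_cast hr1)
  refine squeeze_zero_norm' ?_ hr
  filter_upwards [(spectrum.pow_nnnorm_pow_one_div_tendsto_nhds_spectralRadius a).eventually_lt_const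
    har, eventually_gt_atTop 0] with k hk hk0
  rw [one_div, ENNReal.rpow_inv_lt_iff (by positivity), ENNReal.rpow_natCast] at hk
  exact_mod_cast hk.le

section

attribute [local instance] Matrix.linftyOpNormedRing Matrix.linftyOpNormedAlgebra

theorem Matrix.tendsto_pow_of_spectrum_norm_lt_one {B : Matrix n n ℂ}
    (hB : ∀ μ ∈ spectrum ℂ B, ‖μ‖ < 1) : Tendsto (fun k : ℕ => B ^ k) atTop (𝓝 0) := by
  nontriviality Matrix n n ℂ
  refine tendsto_pow_atTop_nhds_zero_of_spectralRadius_lt_one ?_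
  exact_mod_cast spectrum.spectralRadius_lt_of_forall_lt B (r := 1) fun μ hμ => by
    exact_mod_cast hB μ hμ

end

end Spectrum

/-- A Hermitian solution of a Stein equation with positive definite right-hand side is positive
definite when the powers of the coefficient tend to zero. -/
theorem Matrix.PosDef.of_sub_conj_of_tendsto_pow {n : Type*} [Fintype n] [DecidableEq n]
    {B Q : Matrix n n ℝ} (hQ : Q.IsHermitian) (hS : (Q - Bᵀ * Q * B).PosDef)
    (hB : Tendsto (fun k : ℕ => B ^ k) atTop (𝓝 0)) : Q.PosDef := by
  have hstep (x : n → ℝ) : x ⬝ᵥ (Q - Bᵀ * Q * B) *ᵥ x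
      = x ⬝ᵥ Q *ᵥ x - (B *ᵥ x) ⬝ᵥ Q *ᵥ (B *ᵥ x) := by
    simp only [sub_mulVec, dotProduct_sub, ← mulVec_mulVec, dotProduct_mulVec, vecMul_transpose]
  have hle (x : n → ℝ) : (B *ᵥ x) ⬝ᵥ Q *ᵥ (B *ᵥ x) ≤ x ⬝ᵥ Q *ᵥ x := by
    have := hS.posSemidef.dotProduct_mulVec_nonneg x
    simp only [star_trivial, hstep] at this
    linarith
  have hnonneg (x : n → ℝ) : 0 ≤ x ⬝ᵥ Q *ᵥ x := by
    have hanti : Antitone fun k : ℕ => (B ^ k *ᵥ x) ⬝ᵥ Q *ᵥ (B ^ k *ᵥ x) :=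
      antitone_nat_of_succ_le fun k => by
        simpa only [pow_succ', ← mulVec_mulVec] using hle (B ^ k *ᵥ x)
    have hcont : Continuous fun P : Matrix n n ℝ => (P *ᵥ x) ⬝ᵥ Q *ᵥ (P *ᵥ x) := by fun_prop
    have hlim := (hcont.tendsto 0).comp hB
    simp only [zero_mulVec, zero_dotProduct] at hlim
    simpa using hanti.le_of_tendsto hlim 0
  refine .of_dotProduct_mulVec_pos hQ fun x hx => ?_
  have := hS.dotProduct_mulVec_pos hx
  simp only [star_trivial, hstep] at this ⊢
  linarith [hnonneg (B *ᵥ x)]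

/-- The Cayley transform maps the open left half-plane into the open unit disc. -/
theorem Complex.norm_lt_one_of_re_cayley_neg {μ : ℂ} (hμ : ((μ - 1) / (μ + 1)).re < 0) :
    ‖μ‖ < 1 := by
  have hne : μ + 1 ≠ 0 := by
    intro h
    simp [h] at hμ
  have hpos : 0 < normSq (μ + 1) := normSq_pos.mpr hne
  rw [div_re, ← add_div, div_lt_iff₀ hpos] at hμ
  simp at hμ
  rw [← sq_lt_one_iff₀ (norm_nonneg _), ← normSq_eq_norm_sq, normSq_apply]
  nlinarith

section Lyapunov

variable {N : ℕ} {A : Matrix (Fin N) (Fin N) ℝ}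

theorem IsHurwitz.isUnit_one_sub (hA : IsHurwitz A) : IsUnit (1 - A) := by
  have h1 : (1 : ℂ) ∉ spectrum ℂ (A.map Complex.ofReal) := fun h => by
    have := hA 1 h
    norm_num at this
  rw [spectrum.notMem_iff, map_one] at h1
  rw [Matrix.isUnit_iff_isUnit_det, isUnit_iff_ne_zero] at h1 ⊢
  intro h
  apply h1
  have : (1 : Matrix (Fin N) (Fin N) ℂ) - A.map Complex.ofReal
      = Complex.ofRealHom.mapMatrix (1 - A) := by
    rw [map_sub, map_one]
    rfl
  rw [this, ← RingHom.map_det, h, map_zero]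

theorem IsHurwitz.tendsto_cayley_pow (hA : IsHurwitz A) {R : Matrix (Fin N) (Fin N) ℝ}
    (hR : (1 - A) * R = 1) :
    Tendsto (fun k : ℕ => ((1 + A) * R) ^ k) atTop (𝓝 0) := by
  set φ : Matrix (Fin N) (Fin N) ℝ →+* Matrix (Fin N) (Fin N) ℂ := Complex.ofRealHom.mapMatrix
  have hR' : (1 - φ A) * φ R = 1 := by
    simpa using congrArg φ hR
  have hR'' : φ R * (1 - φ A) = 1 := mul_eq_one_comm.mp hR'
  have hspec : ∀ μ ∈ spectrum ℂ (φ ((1 + A) * R)), ‖μ‖ < 1 := by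
    intro μ hμ
    rw [spectrum.mem_iff] at hμ
    have hfac : (algebraMap ℂ (Matrix (Fin N) (Fin N) ℂ) μ - φ ((1 + A) * R))
        = (algebraMap ℂ _ (μ - 1) - (μ + 1) • φ A) * φ R := by
      have : algebraMap ℂ (Matrix (Fin N) (Fin N) ℂ) μ = μ • ((1 - φ A) * φ R) := by
        rw [hR', Algebra.algebraMap_eq_smul_one]
      rw [this, Algebra.algebraMap_eq_smul_one, map_mul, map_add, map_one, ← smul_mul_assoc,
        ← sub_mul]
      congr 1
      module
    have hRu : IsUnit (φ R) := ⟨⟨φ R, 1 - φ A, hR'', hR'⟩, rfl⟩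
    have hnu : ¬ IsUnit (algebraMap ℂ (Matrix (Fin N) (Fin N) ℂ) (μ - 1) - (μ + 1) • φ A) :=
      fun h => hμ (hfac ▸ h.mul hRu)
    have hne : μ + 1 ≠ 0 := by
      intro h
      apply hnu
      rw [h, zero_smul, sub_zero]
      refine (IsUnit.mk0 _ fun h' => ?_).map _
      have : (2 : ℂ) = 0 := by linear_combination h - h'
      norm_num at this
    refine Complex.norm_lt_one_of_re_cayley_neg (hA _ ?_)
    rw [spectrum.mem_iff]
    intro h
    apply hnu
    have : algebraMap ℂ (Matrix (Fin N) (Fin N) ℂ) (μ - 1) - (μ + 1) • φ A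
        = algebraMap ℂ _ (μ + 1) * (algebraMap ℂ _ ((μ - 1) / (μ + 1)) - φ A) := by
      rw [mul_sub, ← map_mul, mul_div_cancel₀ _ hne, ← Algebra.smul_def]
    rw [this]
    exact ((IsUnit.mk0 _ hne).map _).mul h
  have hlim := Matrix.tendsto_pow_of_spectrum_norm_lt_one hspec
  have hre : Continuous fun P : Matrix (Fin N) (Fin N) ℂ => P.map Complex.re :=
    continuous_id.matrix_map Complex.continuous_re
  convert (hre.tendsto 0).comp hlim using 2
  · rw [Function.comp_apply, ← map_pow]
    ext i j
    simp [φ]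
  · ext i j
    simp

theorem IsHurwitz.posDef_of_lyapunov (hA : IsHurwitz A) {Q M : Matrix (Fin N) (Fin N) ℝ}
    (hQ : Q.IsHermitian) (hM : M.PosDef) (h : Aᵀ * Q + Q * A + M = 0) : Q.PosDef := by
  obtain ⟨R, hR⟩ := hA.isUnit_one_sub.exists_right_inv
  refine .of_sub_conj_of_tendsto_pow hQ ?_ (hA.tendsto_cayley_pow hR)
  have hRt : Rᵀ * (1 - Aᵀ) = 1 := by
    simpa using congrArg transpose hR
  have hMeq : M = -(Aᵀ * Q + Q * A) := (neg_eq_of_add_eq_zero_right h).symm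
  have hS : Q - ((1 + A) * R)ᵀ * Q * ((1 + A) * R) = Rᵀ * ((2 : ℝ) • M) * R := by
    calc _ = (Rᵀ * (1 - Aᵀ)) * Q * ((1 - A) * R) - ((1 + A) * R)ᵀ * Q * ((1 + A) * R) := by
          rw [hR, hRt, one_mul, mul_one]
      _ = Rᵀ * ((2 : ℝ) • M) * R := by
          rw [hMeq, two_smul]
          simp only [transpose_mul, transpose_add, transpose_one]
          noncomm_ring
  rw [hS]
  refine (hM.smul two_pos).conjTranspose_mul_mul_same (B := R) ?_
  exact mulVec_injective_of_isUnit ⟨⟨R, 1 - A, mul_eq_one_comm.mp hR, hR⟩, rfl⟩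

theorem IsHurwitz.eq_zero_of_lyapunov (hA : IsHurwitz A) {X : Matrix (Fin N) (Fin N) ℝ}
    (h : Aᵀ * X + X * A = 0) : X = 0 := by
  set φ : Matrix (Fin N) (Fin N) ℝ →+* Matrix (Fin N) (Fin N) ℂ := Complex.ofRealHom.mapMatrix
  have hφ : SemiconjBy (φ X) (-φ A) (φ A)ᵀ := by
    have h' : φ Aᵀ * φ X + φ X * φ A = 0 := by
      simpa using congrArg φ h
    rw [SemiconjBy, mul_neg]
    exact (eq_neg_of_add_eq_zero_left h').symm
  have hX : φ X = 0 := by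
    refine Matrix.eq_zero_of_semiconjBy_of_disjoint_spectrum hφ ?_
    rw [Set.disjoint_left]
    intro μ h1 h2
    rw [← spectrum.neg_eq, Set.mem_neg] at h1
    rw [Matrix.mem_spectrum_iff_isRoot_charpoly, Matrix.charpoly_transpose,
      ← Matrix.mem_spectrum_iff_isRoot_charpoly] at h2
    have h1' := hA _ h1
    have h2' := hA _ h2
    rw [Complex.neg_re] at h1'
    linarith
  exact (Matrix.map_injective Complex.ofReal_injective) (hX.trans (map_zero φ).symm)

theorem IsHurwitz.existsUnique_lyapunov (hA : IsHurwitz A) (M : Matrix (Fin N) (Fin N) ℝ) :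
    ∃! Q : Matrix (Fin N) (Fin N) ℝ, Aᵀ * Q + Q * A + M = 0 := by
  let L : Matrix (Fin N) (Fin N) ℝ →ₗ[ℝ] Matrix (Fin N) (Fin N) ℝ :=
    LinearMap.mulLeft ℝ Aᵀ + LinearMap.mulRight ℝ A
  have hinj : Function.Injective L :=
    (injective_iff_map_eq_zero L).mpr fun X hX => hA.eq_zero_of_lyapunov hX
  obtain ⟨Q, hQ, huniq⟩ :=
    Function.Bijective.existsUnique ⟨hinj, LinearMap.injective_iff_surjective.mp hinj⟩ (-M)
  exact ⟨Q, eq_neg_iff_add_eq_zero.mp hQ, fun Q' h => huniq Q' (eq_neg_of_add_eq_zero_left h)⟩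

end Lyapunov

theorem stmt4 {N p : ℕ}
    (A : Matrix (Fin N) (Fin N) ℝ) (C : Matrix (Fin p) (Fin N) ℝ)
    (hA : IsHurwitz A) (hC : (Cᵀ * C).PosDef) :
    ∃! Q : Matrix (Fin N) (Fin N) ℝ,
      Q.IsSymm ∧ Q.PosDef ∧ Aᵀ * Q + Q * A + Cᵀ * C = 0 := by
  obtain ⟨Q, hQ, huniq⟩ := hA.existsUnique_lyapunov (Cᵀ * C)
  have hsymm : Qᵀ = Q := huniq Qᵀ <| by
    simpa [add_comm (Qᵀ * A)] using congrArg transpose hQ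
  exact ⟨Q, ⟨hsymm, hA.posDef_of_lyapunov hsymm hC hQ, hQ⟩, fun Q' h => huniq Q' h.2.2⟩
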